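/- Consider the additive Gaussian noise channel Y = X + N, where N ∼ N(0, ηI_d) is independent of X and η > 0 is the noise level, so that the kernel is P_{Y|X}^{(η)}(·|x) = N(x, ηI_d) on ℝ^d. Let P_X = α P_C + (1−α) P_D with 0 ≤ α ≤ 1, where P_C is a probability measure absolutely continuous with respect to d-dimensional Lebesgue measure and P_D is a purely atomic (purely discontinuous) probability measure. Then lim_{η→0} ZZ(P_X, P_{Y|X}^{(η)}, 2)/η = α·d. -/

import Mathlib

open MeasureTheory ProbabilityTheory ENNReal

noncomputable section

variable {d : ℕ} {𝒴 : Type*} [MeasurableSpace 𝒴]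

/-- Law of `X - u` when `X ∼ P`. -/
def shiftLaw (P : Measure (Fin d → ℝ)) (u : Fin d → ℝ) : Measure (Fin d → ℝ) :=
  P.map (· - u)

/-- The mixture measure `μ_U = ∑_k P_{X-u_k}`. -/
def mixMeasure (P : Measure (Fin d → ℝ)) {M : ℕ} (U : Fin M → Fin d → ℝ) :
    Measure (Fin d → ℝ) :=
  ∑ k : Fin M, shiftLaw P (U k)

/-- The prior `p_i(x) = dP_{X-u_i}/dμ_U (x)`. -/
def prior (P : Measure (Fin d → ℝ)) {M : ℕ} (U : Fin M → Fin d → ℝ) (i : Fin M)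
    (x : Fin d → ℝ) : ℝ≥0∞ :=
  (shiftLaw P (U i)).rnDeriv (mixMeasure P U) x

/-- Minimum Bayes error probability of the `M`-ary hypothesis test where hypothesis `i`
has prior `p_i(x)` and observation law `κ(·|x+u_i)`. -/
def bayesError (P : Measure (Fin d → ℝ)) (κ : Kernel (Fin d → ℝ) 𝒴) {M : ℕ}
    (U : Fin M → Fin d → ℝ) (x : Fin d → ℝ) : ℝ≥0∞ :=
  ⨅ (φ : 𝒴 → Fin M) (_ : Measurable φ),
    ∑ i : Fin M, prior P U i x * κ (x + U i) {y | φ y ≠ i}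

/-- `h(t,i,M)`. -/
def hFun (P : Measure (Fin d → ℝ)) (κ : Kernel (Fin d → ℝ) 𝒴) (M : ℕ) (t : ℝ)
    (i : Fin d) : ℝ≥0∞ :=
  ⨆ (U : Fin M → Fin d → ℝ) (_ : ∀ k : Fin M, U k i = (k : ℝ) * t),
    ∫⁻ x, bayesError P κ U x ∂(mixMeasure P U)

/-- Ziv-Zakai bound without valley-filling. -/
def ZZ (P : Measure (Fin d → ℝ)) (κ : Kernel (Fin d → ℝ) 𝒴) (M : ℕ) : ℝ≥0∞ :=
  ∑ i : Fin d, ∫⁻ t in Set.Ioi (0 : ℝ),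
    ENNReal.ofReal (t / 2) * (hFun P κ M t i / ((M : ℝ≥0∞) - 1))


/-- The additive Gaussian noise kernel on `ℝ^d` with noise level `η`:
`κ(·|x)` is the law of `x + N` where `N ∼ N(0, ηI_d)`. -/
def gaussKernel (d : ℕ) (η : NNReal) : Kernel (Fin d → ℝ) (Fin d → ℝ) :=
  Kernel.map
    (Kernel.prod Kernel.id
      (Kernel.const _ (Measure.pi fun _ : Fin d => gaussianReal 0 η)))
    (fun p => p.1 + p.2)

/-- The two-sided Gaussian tail `P(|N| ≥ t / 2)` for `N ∼ N(0, η)`. -/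
def twoTail (η : NNReal) (t : ℝ) : ℝ≥0∞ := gaussianReal 0 η {y | t ≤ |2 * y|}

lemma twoTail_le_one (η : NNReal) (t : ℝ) : twoTail η t ≤ 1 := prob_le_one

lemma twoTail_antitone (η : NNReal) : Antitone (twoTail η) :=
  fun _ _ hst => measure_mono fun _ hy => le_trans hst hy

lemma twoTail_sqrt_mul {η : NNReal} (hη : 0 < η) (s : ℝ) :
    twoTail η (√η * s) = twoTail 1 s := by
  have hpos : 0 < √(η : ℝ) := Real.sqrt_pos.2 (by exact_mod_cast hη)
  have hmap : (gaussianReal 0 1).map (√(η : ℝ) * ·) = gaussianReal 0 η := by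
    rw [gaussianReal_map_const_mul]
    congr 1
    · simp
    · ext; simp
  rw [twoTail, ← hmap, Measure.map_apply (by fun_prop)
    (measurableSet_le (by fun_prop) (by fun_prop)), twoTail]
  congr 1
  ext y
  simp only [Set.preimage_ofPred_eq, Set.mem_ofPred_eq]
  rw [show 2 * (√(η : ℝ) * y) = √(η : ℝ) * (2 * y) by ring, abs_mul, abs_of_pos hpos,
    mul_le_mul_iff_right₀ hpos]

lemma lintegral_twoTail :
    ∫⁻ s in Set.Ioi (0 : ℝ), ENNReal.ofReal (s / 2) * twoTail 1 s = 1 := by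
  have h := lintegral_comp_eq_lintegral_meas_le_mul (gaussianReal 0 1) (f := fun y => |2 * y|)
    (g := fun s => s / 2) (Filter.Eventually.of_forall fun y => abs_nonneg _)
    (by fun_prop) (fun t _ => (by fun_prop : Continuous fun s : ℝ => s / 2).intervalIntegrable _ _)
    (by
      filter_upwards [self_mem_ae_restrict measurableSet_Ioi] with t ht
      have : (0 : ℝ) < t := ht
      positivity)
  simp_rw [mul_comm (ENNReal.ofReal _)]
  refine h.symm.trans ?_
  have hint : ∀ y : ℝ, ∫ s in (0 : ℝ)..|2 * y|, s / 2 = y ^ 2 := by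
    intro y
    simp only [intervalIntegral.integral_div, integral_id, sq_abs]
    ring
  simp_rw [hint]
  rw [← ofReal_integral_eq_lintegral_ofReal]
  · have hv := variance_eq_integral (μ := gaussianReal 0 1) (X := id) (by fun_prop)
    rw [variance_id_gaussianReal] at hv
    simp only [id_eq, integral_id_gaussianReal, sub_zero] at hv
    rw [← hv]; simp
  · exact (memLp_id_gaussianReal 2).integrable_sq
  · exact Filter.Eventually.of_forall fun y => sq_nonneg y

lemma gaussianReal_zero_Ici_add_Iic {η : NNReal} {t : ℝ} (ht : 0 < t) :
    gaussianReal 0 η (Set.Ici (t / 2)) + gaussianReal 0 η (Set.Iic (-(t / 2))) = twoTail η t := by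
  rw [twoTail, ← measure_union _ measurableSet_Iic]
  · congr 1
    ext y
    simp only [Set.mem_union, Set.mem_Ici, Set.mem_Iic, Set.mem_ofPred_eq, le_abs]
    constructor <;> (rintro (h | h) <;> [left; right] <;> linarith)
  · rw [Set.disjoint_left]
    intro y hy hy'
    simp only [Set.mem_Ici, Set.mem_Iic] at hy hy'
    linarith

lemma gaussianReal_apply_zero_mean (m : ℝ) (η : NNReal) {s : Set ℝ} (hs : MeasurableSet s) :
    gaussianReal m η s = gaussianReal 0 η ((m + ·) ⁻¹' s) := by
  rw [← Measure.map_apply (by fun_prop) hs, gaussianReal_map_const_add, zero_add]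

lemma gaussianReal_Ici_add_Iic (m : ℝ) {η : NNReal} {t : ℝ} (ht : 0 < t) :
    gaussianReal m η (Set.Ici (m + t / 2)) + gaussianReal (m + t) η (Set.Iic (m + t / 2))
      = twoTail η t := by
  rw [← gaussianReal_zero_Ici_add_Iic ht, gaussianReal_apply_zero_mean m η measurableSet_Ici,
    gaussianReal_apply_zero_mean (m + t) η measurableSet_Iic]
  congr 2 <;> ext y <;> simp
  constructor <;> intro h <;> linarith

/-- Two Gaussians at distance `t` dominate a common measure of mass `twoTail η t`. -/
lemma exists_le_gaussianReal (m : ℝ) {η : NNReal} (hη : 0 < η) {t : ℝ} (ht : 0 < t) :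
    ∃ ν : Measure ℝ, ν ≤ gaussianReal m η ∧ ν ≤ gaussianReal (m + t) η ∧
      ν Set.univ = twoTail η t := by
  have hη0 : η ≠ 0 := hη.ne'
  refine ⟨(gaussianReal m η).restrict (Set.Ici (m + t / 2))
    + (gaussianReal (m + t) η).restrict (Set.Iio (m + t / 2)), ?_, ?_, ?_⟩
  · conv_rhs => rw [← Measure.restrict_add_restrict_compl (s := Set.Ici (m + t / 2))
      (μ := gaussianReal m η) measurableSet_Ici, Set.compl_Ici]
    refine add_le_add le_rfl ?_
    rw [gaussianReal_of_var_ne_zero _ hη0, gaussianReal_of_var_ne_zero _ hη0,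
      restrict_withDensity measurableSet_Iio, restrict_withDensity measurableSet_Iio]
    refine withDensity_mono ?_
    filter_upwards [self_mem_ae_restrict measurableSet_Iio] with y hy
    have hy : y < m + t / 2 := hy
    simp only [gaussianPDF, gaussianPDFReal]
    gcongr ENNReal.ofReal (_ * Real.exp (-?_ / _))
    nlinarith
  · conv_rhs => rw [← Measure.restrict_add_restrict_compl (s := Set.Ici (m + t / 2))
      (μ := gaussianReal (m + t) η) measurableSet_Ici, Set.compl_Ici]
    refine add_le_add ?_ le_rfl
    rw [gaussianReal_of_var_ne_zero _ hη0, gaussianReal_of_var_ne_zero _ hη0,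
      restrict_withDensity measurableSet_Ici, restrict_withDensity measurableSet_Ici]
    refine withDensity_mono ?_
    filter_upwards [self_mem_ae_restrict measurableSet_Ici] with y hy
    have hy : m + t / 2 ≤ y := hy
    simp only [gaussianPDF, gaussianPDFReal]
    gcongr ENNReal.ofReal (_ * Real.exp (-?_ / _))
    nlinarith
  · have := nullSingletonClass_gaussianReal (μ := m + t) hη0
    rw [← gaussianReal_Ici_add_Iic m ht, Measure.add_apply,
      Measure.restrict_apply_univ, Measure.restrict_apply_univ, measure_congr Iio_ae_eq_Iic]

lemma gaussKernel_apply {d : ℕ} (η : NNReal) (x : Fin d → ℝ) :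
    gaussKernel d η x = Measure.pi fun j => gaussianReal (x j) η := by
  have : (fun p : (Fin d → ℝ) × (Fin d → ℝ) => p.1 + p.2) ∘ Prod.mk x
      = fun (y : Fin d → ℝ) j => x j + y j := rfl
  rw [gaussKernel, Kernel.map_apply _ (by fun_prop), Kernel.prod_apply, Kernel.id_apply,
    Kernel.const_apply, Measure.dirac_prod, Measure.map_map (by fun_prop) (by fun_prop), this,
    Measure.pi_map_pi (fun _ => by fun_prop)]
  simp_rw [gaussianReal_map_const_add, zero_add]

instance {d : ℕ} (η : NNReal) : IsMarkovKernel (gaussKernel d η) :=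
  ⟨fun x => by rw [gaussKernel_apply]; infer_instance⟩

lemma gaussKernel_eval {d : ℕ} (η : NNReal) (x : Fin d → ℝ) (i : Fin d) {s : Set ℝ}
    (hs : MeasurableSet s) : gaussKernel d η x {y | y i ∈ s} = gaussianReal (x i) η s := by
  rw [gaussKernel_apply]
  exact (measurePreserving_eval (fun j => gaussianReal (x j) η) i).measure_preimage
    hs.nullMeasurableSet

lemma measure_pi_mono {ι : Type*} [Fintype ι] {X : ι → Type*} [∀ i, MeasurableSpace (X i)]
    {μ ν : ∀ i, Measure (X i)} [∀ i, SigmaFinite (μ i)] [∀ i, SigmaFinite (ν i)]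
    (h : ∀ i, μ i ≤ ν i) : Measure.pi μ ≤ Measure.pi ν := by
  refine Measure.le_iff.2 fun s hs => ?_
  rw [Measure.pi, Measure.pi, toMeasure_apply _ _ hs, toMeasure_apply _ _ hs]
  refine (OuterMeasure.le_pi.2 fun t ht => ?_) s
  refine (OuterMeasure.pi_pi_le _ _).trans ?_
  exact Finset.prod_le_prod' fun i _ => h i _

lemma twoTail_le_gaussKernel_add {d : ℕ} {η : NNReal} (hη : 0 < η) {t : ℝ} (ht : 0 < t)
    (i : Fin d) (x : Fin d → ℝ) {B : Set (Fin d → ℝ)} (hB : MeasurableSet B) :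
    twoTail η t ≤ gaussKernel d η x B + gaussKernel d η (x + Pi.single i t) Bᶜ := by
  obtain ⟨ν, h₀, h₁, hν⟩ := exists_le_gaussianReal (x i) hη ht
  have : IsFiniteMeasure ν := ⟨by rw [hν]; exact (twoTail_le_one η t).trans_lt one_lt_top⟩
  let ρ : Fin d → Measure ℝ := Function.update (fun j => gaussianReal (x j) η) i ν
  have hρ : ∀ j, IsFiniteMeasure (ρ j) := by
    intro j
    by_cases hj : j = i
    · subst hj; simpa [ρ] using this
    · simp only [ρ, Function.update_of_ne hj]; infer_instance
  have hle₀ : Measure.pi ρ ≤ gaussKernel d η x := by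
    rw [gaussKernel_apply]
    refine measure_pi_mono fun j => ?_
    by_cases hj : j = i
    · subst hj; simpa [ρ] using h₀
    · simp [ρ, Function.update_of_ne hj]
  have hle₁ : Measure.pi ρ ≤ gaussKernel d η (x + Pi.single i t) := by
    rw [gaussKernel_apply]
    refine measure_pi_mono fun j => ?_
    by_cases hj : j = i
    · subst hj; simpa [ρ] using h₁
    · simp [ρ, Function.update_of_ne hj, Pi.single_eq_of_ne hj]
  have huniv : Measure.pi ρ Set.univ = twoTail η t := by
    rw [Measure.pi_univ, Finset.prod_eq_single i]
    · simp [ρ, hν]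
    · intro j _ hj; simp [ρ, Function.update_of_ne hj]
    · simp
  rw [← huniv, ← measure_add_measure_compl hB]
  exact add_le_add (hle₀ _) (hle₁ _)

lemma lintegral_rescale {η : NNReal} (hη : 0 < η) (H : ℝ → ℝ≥0∞) :
    (∫⁻ t in Set.Ioi (0 : ℝ), ENNReal.ofReal (t / 2) * H t) / (η : ℝ≥0∞)
      = ∫⁻ s in Set.Ioi (0 : ℝ), ENNReal.ofReal (s / 2) * H (√η * s) := by
  have hpos : 0 < √(η : ℝ) := Real.sqrt_pos.2 (by exact_mod_cast hη)
  have himg : (√(η : ℝ) * ·) '' Set.Ioi (0 : ℝ) = Set.Ioi 0 := by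
    rw [Set.image_mul_left_Ioi hpos, mul_zero]
  have h := lintegral_image_eq_lintegral_abs_deriv_mul (s := Set.Ioi (0 : ℝ))
    (f := (√(η : ℝ) * ·)) (f' := fun _ => √(η : ℝ)) measurableSet_Ioi
    (fun x _ => by simpa using ((hasDerivAt_id x).const_mul √(η : ℝ)).hasDerivWithinAt)
    (mul_right_injective₀ hpos.ne').injOn (fun t => ENNReal.ofReal (t / 2) * H t)
  rw [himg] at h
  have hη0 : (η : ℝ≥0∞) ≠ 0 := by exact_mod_cast hη.ne'
  rw [h, ENNReal.div_eq_inv_mul, ← lintegral_const_mul' _ _ (by simpa using hη.ne')]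
  refine lintegral_congr fun s => ?_
  have hsq : ENNReal.ofReal √(η : ℝ) * ENNReal.ofReal √(η : ℝ) = η := by
    rw [← ENNReal.ofReal_mul hpos.le, Real.mul_self_sqrt η.coe_nonneg]
    simp
  calc _ = (η : ℝ≥0∞)⁻¹ * (ENNReal.ofReal √(η : ℝ) * ENNReal.ofReal √(η : ℝ)) *
        (ENNReal.ofReal (s / 2) * H (√η * s)) := by
        rw [abs_of_pos hpos, mul_div_assoc, ENNReal.ofReal_mul hpos.le]
        ring
    _ = _ := by rw [hsq, ENNReal.inv_mul_cancel hη0 coe_ne_top, one_mul]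

/-- If `H η t` is dominated by `twoTail η t` and, uniformly in `η`, is close to
`c * twoTail η t` for small `t`, then `η⁻¹ ∫ (t / 2) H η t dt → c`. -/
lemma tendsto_lintegral_div_of_near_twoTail {c : ℝ≥0∞} (hc : c ≤ 1) {H : NNReal → ℝ → ℝ≥0∞}
    (hle : ∀ η, 0 < η → ∀ t, 0 < t → H η t ≤ twoTail η t)
    (hH : ∀ ε : ℝ≥0∞, 0 < ε → ∀ᶠ t in nhdsWithin (0 : ℝ) (Set.Ioi 0), ∀ η, 0 < η →
      H η t ≤ c * twoTail η t + ε ∧ c * twoTail η t ≤ H η t + ε) :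
    Filter.Tendsto
      (fun η : NNReal => (∫⁻ t in Set.Ioi (0 : ℝ), ENNReal.ofReal (t / 2) * H η t) / (η : ℝ≥0∞))
      (nhdsWithin 0 (Set.Ioi 0)) (nhds c) := by
  have hctop : c ≠ ∞ := (hc.trans_lt one_lt_top).ne
  let r : ℝ → ℝ≥0∞ := fun t => ⨆ t' ∈ Set.Ioc 0 t, ⨆ (η : NNReal) (_ : 0 < η),
    max (H η t' - c * twoTail η t') (c * twoTail η t' - H η t')
  have hr_mono : Monotone r := fun s t hst =>
    biSup_mono fun _ h => Set.Ioc_subset_Ioc_right hst h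
  have hr_meas : Measurable r := hr_mono.measurable
  have hr_le : ∀ η, 0 < η → ∀ t, 0 < t →
      max (H η t - c * twoTail η t) (c * twoTail η t - H η t) ≤ r t := fun η hη t ht =>
    le_iSup₂_of_le (f := fun t' (_ : t' ∈ Set.Ioc 0 t) => ⨆ (η : NNReal) (_ : 0 < η),
      max (H η t' - c * twoTail η t') (c * twoTail η t' - H η t')) t ⟨ht, le_rfl⟩
      (le_iSup₂_of_le η hη le_rfl)
  have hr_lim : Filter.Tendsto r (nhdsWithin 0 (Set.Ioi 0)) (nhds 0) := by
    refine ENNReal.tendsto_nhds_zero.2 fun ε hε => ?_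
    obtain ⟨δ, hδ, hsub⟩ := mem_nhdsGT_iff_exists_Ioo_subset.1 (hH ε hε)
    filter_upwards [Ioo_mem_nhdsGT hδ] with t ht
    refine iSup₂_le fun t' ht' => iSup₂_le fun η hη => ?_
    obtain ⟨h1, h2⟩ := hsub ⟨ht'.1, ht'.2.trans_lt ht.2⟩ η hη
    exact max_le (tsub_le_iff_left.2 h1) (tsub_le_iff_left.2 h2)
  have hscale : ∀ s : ℝ, 0 < s → Filter.Tendsto (fun η : NNReal => r (√η * s))
      (nhdsWithin 0 (Set.Ioi 0)) (nhds 0) := by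
    intro s hs
    refine hr_lim.comp (tendsto_nhdsWithin_iff.2 ⟨?_, ?_⟩)
    · have : Continuous fun η : NNReal => √(η : ℝ) * s := by fun_prop
      simpa using (this.tendsto 0).mono_left nhdsWithin_le_nhds
    · filter_upwards [self_mem_nhdsWithin] with η hη
      exact mul_pos (Real.sqrt_pos.2 (by exact_mod_cast hη)) hs
  have hlim : ∫⁻ s in Set.Ioi (0 : ℝ), ENNReal.ofReal (s / 2) * (c * twoTail 1 s) = c := by
    simp_rw [mul_left_comm _ c]
    rw [lintegral_const_mul' _ _ hctop, lintegral_twoTail, mul_one]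
  have hW_meas : Measurable (twoTail 1) := (twoTail_antitone 1).measurable
  have hfin : ∫⁻ s in Set.Ioi (0 : ℝ), ENNReal.ofReal (s / 2) * twoTail 1 s ≠ ∞ := by
    rw [lintegral_twoTail]; exact one_ne_top
  have hcW : ∀ s, c * twoTail 1 s ≤ twoTail 1 s := fun s => mul_le_of_le_one_left' hc
  have hcW_top : ∀ s, c * twoTail 1 s ≠ ∞ := fun s =>
    mul_ne_top hctop ((twoTail_le_one 1 s).trans_lt one_lt_top).ne
  have hlower : Filter.Tendsto (fun η : NNReal => ∫⁻ s in Set.Ioi (0 : ℝ),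
      ENNReal.ofReal (s / 2) * (c * twoTail 1 s - r (√η * s)))
      (nhdsWithin 0 (Set.Ioi 0)) (nhds c) := by
    conv => enter [3, 1]; rw [← hlim]
    refine tendsto_lintegral_filter_of_dominated_convergence _
      (.of_forall fun η => by fun_prop)
      (.of_forall fun η => .of_forall fun s => mul_le_mul_right (tsub_le_self.trans (hcW s)) _)
      hfin ?_
    filter_upwards [self_mem_ae_restrict measurableSet_Ioi] with s hs
    refine ENNReal.Tendsto.const_mul ?_ (Or.inr ofReal_ne_top)
    simpa using ENNReal.Tendsto.sub tendsto_const_nhds (hscale s hs) (Or.inl (hcW_top s))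
  have hupper : Filter.Tendsto (fun η : NNReal => ∫⁻ s in Set.Ioi (0 : ℝ),
      ENNReal.ofReal (s / 2) * min (twoTail 1 s) (c * twoTail 1 s + r (√η * s)))
      (nhdsWithin 0 (Set.Ioi 0)) (nhds c) := by
    conv => enter [3, 1]; rw [← hlim]
    refine tendsto_lintegral_filter_of_dominated_convergence _
      (.of_forall fun η => by fun_prop)
      (.of_forall fun η => .of_forall fun s => mul_le_mul_right (min_le_left _ _) _)
      hfin ?_
    filter_upwards [self_mem_ae_restrict measurableSet_Ioi] with s hs
    refine ENNReal.Tendsto.const_mul ?_ (Or.inr ofReal_ne_top)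
    have := (tendsto_const_nhds (x := twoTail 1 s)).min
      ((tendsto_const_nhds (x := c * twoTail 1 s)).add (hscale s hs))
    simpa [min_eq_right (hcW s)] using this
  refine tendsto_of_tendsto_of_tendsto_of_le_of_le' hlower hupper ?_ ?_
  all_goals
    filter_upwards [self_mem_nhdsWithin] with η (hη : 0 < η)
    rw [lintegral_rescale hη]
    refine lintegral_mono_ae ?_
    filter_upwards [self_mem_ae_restrict measurableSet_Ioi] with s (hs : 0 < s)
    have hpos : 0 < √(η : ℝ) * s := mul_pos (Real.sqrt_pos.2 (by exact_mod_cast hη)) hs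
    obtain ⟨h1, h2⟩ := max_le_iff.1 (hr_le η hη _ hpos)
    have h3 := hle η hη _ hpos
    rw [twoTail_sqrt_mul hη] at h1 h2 h3
    gcongr
  · exact tsub_le_iff_tsub_le.1 h2
  · exact le_min h3 (tsub_le_iff_left.1 h1)

lemma shiftLaw_apply {d : ℕ} (P : Measure (Fin d → ℝ)) (u : Fin d → ℝ) (s : Set (Fin d → ℝ)) :
    shiftLaw P u s = P ((· - u) ⁻¹' s) :=
  (MeasurableEquiv.subRight u).map_apply s

instance {d : ℕ} (P : Measure (Fin d → ℝ)) [IsProbabilityMeasure P] (u : Fin d → ℝ) :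
    IsProbabilityMeasure (shiftLaw P u) :=
  Measure.isProbabilityMeasure_map (by fun_prop)

instance {d M : ℕ} (P : Measure (Fin d → ℝ)) [IsProbabilityMeasure P]
    (U : Fin M → Fin d → ℝ) : IsFiniteMeasure (mixMeasure P U) := by
  unfold mixMeasure; infer_instance

lemma setLIntegral_prior {d M : ℕ} (P : Measure (Fin d → ℝ)) [IsProbabilityMeasure P]
    (U : Fin M → Fin d → ℝ) (i : Fin M) (s : Set (Fin d → ℝ)) :
    ∫⁻ x in s, prior P U i x ∂(mixMeasure P U) = shiftLaw P (U i) s := by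
  have hac : shiftLaw P (U i) ≪ mixMeasure P U := Measure.absolutelyContinuous_of_le <|
    Finset.single_le_sum (f := fun k => shiftLaw P (U k)) (fun _ _ => Measure.zero_le _)
    (Finset.mem_univ i)
  have : SFinite (shiftLaw P (U i)) := inferInstance
  exact Measure.setLIntegral_rnDeriv hac s

lemma measurable_prior {d M : ℕ} (P : Measure (Fin d → ℝ)) (U : Fin M → Fin d → ℝ) (i : Fin M) :
    Measurable (prior P U i) := Measure.measurable_rnDeriv _ _

section BinaryTest

variable {d : ℕ} {P : Measure (Fin d → ℝ)} {U : Fin 2 → Fin d → ℝ}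

lemma bayesError_le_of_const {κ : Kernel (Fin d → ℝ) (Fin d → ℝ)} [IsMarkovKernel κ]
    (i j : Fin 2) (hij : i ≠ j) (x : Fin d → ℝ) : bayesError P κ U x ≤ prior P U i x := by
  refine (iInf₂_le (fun _ => j) measurable_const).trans ?_
  rw [Finset.sum_eq_single i]
  · simp [hij.symm]
  · intro k _ hk
    have : j = k := by omega
    simp [this]
  · simp

/-- The Bayes error is at most the error of the threshold test on the `i`-th coordinate. -/
lemma bayesError_le_threshold {η : NNReal} {i : Fin d} {t : ℝ}
    (hU : ∀ k : Fin 2, U k i = (k : ℝ) * t) (x : Fin d → ℝ) :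
    bayesError P (gaussKernel d η) U x ≤
      prior P U 0 x * gaussianReal 0 η (Set.Ici (t / 2)) +
      prior P U 1 x * gaussianReal 0 η (Set.Iic (-(t / 2))) := by
  classical
  have hA : MeasurableSet {y : Fin d → ℝ | y i ∈ Set.Ici (x i + t / 2)} :=
    measurable_pi_apply i measurableSet_Ici
  refine (iInf₂_le (fun y => if y ∈ {y : Fin d → ℝ | y i ∈ Set.Ici (x i + t / 2)} then 1 else 0)
    (Measurable.ite hA measurable_const measurable_const)).trans ?_
  have h0 : {y : Fin d → ℝ | (if y ∈ {y : Fin d → ℝ | y i ∈ Set.Ici (x i + t / 2)}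
      then (1 : Fin 2) else 0) ≠ 0} = {y | y i ∈ Set.Ici (x i + t / 2)} := by
    ext y; simp
  have h1 : {y : Fin d → ℝ | (if y ∈ {y : Fin d → ℝ | y i ∈ Set.Ici (x i + t / 2)}
      then (1 : Fin 2) else 0) ≠ 1} = {y | y i ∈ Set.Iio (x i + t / 2)} := by
    ext y; simp
  rw [Fin.sum_univ_two, h0, h1, gaussKernel_eval _ _ _ measurableSet_Ici,
    gaussKernel_eval _ _ _ measurableSet_Iio, gaussianReal_apply_zero_mean _ _ measurableSet_Ici,
    gaussianReal_apply_zero_mean _ _ measurableSet_Iio]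
  have hU0 : U 0 i = 0 := by simpa using hU 0
  have hU1 : U 1 i = t := by simpa using hU 1
  gcongr
  · intro y hy
    simp only [Set.mem_preimage, Pi.add_apply, hU0, Set.mem_Ici] at hy ⊢
    linarith
  · intro y hy
    simp only [Set.mem_preimage, Pi.add_apply, hU1, Set.mem_Iio, Set.mem_Iic] at hy ⊢
    linarith

lemma setLIntegral_bayesError_le [IsProbabilityMeasure P] {η : NNReal} {i : Fin d} {t : ℝ}
    (ht : 0 < t) (hU : ∀ k : Fin 2, U k i = (k : ℝ) * t) {s : Set (Fin d → ℝ)} {m : ℝ≥0∞}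
    (hm : ∀ k, shiftLaw P (U k) s ≤ m) :
    ∫⁻ x in s, bayesError P (gaussKernel d η) U x ∂(mixMeasure P U) ≤ m * twoTail η t := by
  calc _ ≤ ∫⁻ x in s, (prior P U 0 x * gaussianReal 0 η (Set.Ici (t / 2)) +
      prior P U 1 x * gaussianReal 0 η (Set.Iic (-(t / 2)))) ∂(mixMeasure P U) :=
        lintegral_mono fun x => bayesError_le_threshold hU x
    _ = shiftLaw P (U 0) s * gaussianReal 0 η (Set.Ici (t / 2)) +
        shiftLaw P (U 1) s * gaussianReal 0 η (Set.Iic (-(t / 2))) := by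
      rw [lintegral_add_left ((measurable_prior P U 0).mul_const _),
        lintegral_mul_const' _ _ (measure_ne_top _ _), lintegral_mul_const' _ _
        (measure_ne_top _ _), setLIntegral_prior, setLIntegral_prior]
    _ ≤ m * twoTail η t := by
      rw [← gaussianReal_zero_Ici_add_Iic ht, mul_add]
      gcongr <;> exact hm _

lemma hFun_gaussKernel_le_twoTail [IsProbabilityMeasure P] {η : NNReal} {t : ℝ} (ht : 0 < t)
    (i : Fin d) : hFun P (gaussKernel d η) 2 t i ≤ twoTail η t := by
  refine iSup₂_le fun U hU => ?_
  rw [← setLIntegral_univ]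
  simpa using setLIntegral_bayesError_le (η := η) (s := Set.univ) (m := 1) ht hU
    fun k => prob_le_one (μ := shiftLaw P (U k))

lemma hFun_gaussKernel_le_add [IsProbabilityMeasure P] {η : NNReal} {t : ℝ} (ht : 0 < t)
    (i : Fin d) {F : Set (Fin d → ℝ)} (hF : F.Finite) {m ε : ℝ≥0∞} (hm : P Fᶜ ≤ m)
    (hε : ∀ G : Set (Fin d → ℝ), G.Finite → Disjoint G F → P G ≤ ε)
    (hsep : ∀ x ∈ F, ∀ y ∈ F, x i - y i ≠ t) :
    hFun P (gaussKernel d η) 2 t i ≤ m * twoTail η t + (ε + ε) := by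
  refine iSup₂_le fun U hU => ?_
  have hU0 : U 0 i = 0 := by simpa using hU 0
  have hU1 : U 1 i = t := by simpa using hU 1
  let A : Fin 2 → Set (Fin d → ℝ) := fun k => (· + U k) ⁻¹' F
  have hA : ∀ j k : Fin 2, j ≠ k →
      ∫⁻ x in A j, bayesError P (gaussKernel d η) U x ∂(mixMeasure P U) ≤ ε := by
    intro j k hjk
    refine (lintegral_mono fun x => bayesError_le_of_const k j hjk.symm x).trans ?_
    rw [setLIntegral_prior, shiftLaw_apply]
    refine hε _ ?_ ?_
    · refine (hF.preimage (add_left_injective _).injOn).preimage (sub_left_injective).injOn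
    · rw [Set.disjoint_left]
      intro x hx hxF
      have hx' : x - U k + U j ∈ F := hx
      have h1 := hsep _ hx' _ hxF
      have h2 := hsep _ hxF _ hx'
      simp only [Pi.add_apply, Pi.sub_apply] at h1 h2
      fin_cases j <;> fin_cases k <;> simp_all
  have hcover : (Set.univ : Set (Fin d → ℝ)) = (A 0 ∪ A 1)ᶜ ∪ (A 0 ∪ A 1) :=
    (Set.compl_union_self _).symm
  rw [← setLIntegral_univ, hcover]
  refine (lintegral_union_le _ _ _).trans (add_le_add ?_ ?_)
  · refine setLIntegral_bayesError_le ht hU fun k => ?_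
    rw [shiftLaw_apply]
    refine (measure_mono (Set.compl_subset_compl.2 fun x hxF => ?_)).trans hm
    have : x - U k ∈ A k := by simpa [A] using hxF
    fin_cases k
    · exact Or.inl this
    · exact Or.inr this
  · exact (lintegral_union_le _ _ _).trans
      (add_le_add (hA 0 1 zero_ne_one) (hA 1 0 one_ne_zero))

lemma min_prior_mul_twoTail_le_bayesError {η : NNReal} (hη : 0 < η) {t : ℝ} (ht : 0 < t)
    (i : Fin d) (h0 : U 0 = 0) (h1 : U 1 = Pi.single i t) (x : Fin d → ℝ) :
    min (prior P U 0 x) (prior P U 1 x) * twoTail η t ≤ bayesError P (gaussKernel d η) U x := by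
  refine le_iInf₂ fun φ hφ => ?_
  have hB : MeasurableSet {y | φ y ≠ 0} := (hφ (measurableSet_singleton 0)).compl
  have hBc : {y | φ y ≠ 1} = {y | φ y ≠ 0}ᶜ := by
    ext y
    simp only [Set.mem_compl_iff, Set.mem_ofPred_eq]
    omega
  rw [Fin.sum_univ_two, h0, h1, hBc, add_zero]
  calc _ ≤ min (prior P U 0 x) (prior P U 1 x) * (gaussKernel d η x {y | φ y ≠ 0} +
        gaussKernel d η (x + Pi.single i t) {y | φ y ≠ 0}ᶜ) := by
        gcongr
        exact twoTail_le_gaussKernel_add hη ht i x hB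
    _ ≤ _ := by
        rw [mul_add]
        gcongr
        · exact min_le_left _ _
        · exact min_le_right _ _

lemma le_lintegral_min_prior [IsProbabilityMeasure P] {ν : Measure (Fin d → ℝ)}
    (hν : ∀ k, ν ≤ shiftLaw P (U k)) :
    ν Set.univ ≤ ∫⁻ x, min (prior P U 0 x) (prior P U 1 x) ∂(mixMeasure P U) := by
  have hA : MeasurableSet {x | prior P U 0 x ≤ prior P U 1 x} :=
    measurableSet_le (measurable_prior P U 0) (measurable_prior P U 1)
  rw [← lintegral_add_compl _ hA, ← measure_add_measure_compl hA]
  refine add_le_add ?_ ?_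
  · refine (hν 0 _).trans ?_
    rw [← setLIntegral_prior]
    exact setLIntegral_mono' hA fun x hx => le_min le_rfl hx
  · refine (hν 1 _).trans ?_
    rw [← setLIntegral_prior]
    exact setLIntegral_mono' hA.compl fun x hx => le_min (le_of_not_ge hx) le_rfl

lemma measure_univ_mul_twoTail_le_hFun [IsProbabilityMeasure P] {η : NNReal} (hη : 0 < η) {t : ℝ}
    (ht : 0 < t) (i : Fin d) {ν : Measure (Fin d → ℝ)} (h0 : ν ≤ shiftLaw P 0)
    (h1 : ν ≤ shiftLaw P (Pi.single i t)) :
    ν Set.univ * twoTail η t ≤ hFun P (gaussKernel d η) 2 t i := by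
  let V : Fin 2 → Fin d → ℝ := ![0, Pi.single i t]
  have hV : ∀ k : Fin 2, V k i = (k : ℝ) * t := by
    intro k; fin_cases k <;> simp [V]
  refine le_trans ?_ (le_iSup₂_of_le V hV le_rfl)
  have hν : ∀ k, ν ≤ shiftLaw P (V k) := by
    intro k
    fin_cases k
    · exact h0
    · exact h1
  have hW : twoTail η t ≠ ∞ := ((twoTail_le_one η t).trans_lt one_lt_top).ne
  calc _ ≤ (∫⁻ x, min (prior P V 0 x) (prior P V 1 x) ∂(mixMeasure P V)) * twoTail η t := by
        gcongr
        exact le_lintegral_min_prior hν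
    _ = ∫⁻ x, min (prior P V 0 x) (prior P V 1 x) * twoTail η t ∂(mixMeasure P V) :=
        (lintegral_mul_const' _ _ hW).symm
    _ ≤ _ := lintegral_mono fun x =>
        min_prior_mul_twoTail_le_bayesError hη ht i rfl rfl x

end BinaryTest

lemma exists_finite_measure_compl_le {X : Type*} [MeasurableSpace X] [MeasurableSingletonClass X]
    (μ : Measure X) [IsFiniteMeasure μ] (hμ : μ {x | μ {x} ≠ 0}ᶜ = 0) {ε : ℝ≥0∞} (hε : 0 < ε) :
    ∃ F : Set X, F.Finite ∧ μ Fᶜ ≤ ε := by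
  let A : ℕ → Set X := fun n => {x | (n : ℝ≥0∞)⁻¹ ≤ μ {x}}
  have hfin : ∀ n, (A n).Finite := fun n =>
    Measure.finite_const_le_meas_of_disjoint_iUnion μ
      (ENNReal.inv_pos.2 (natCast_ne_top n)) (fun x => measurableSet_singleton x)
      (fun x y hxy => by simpa using hxy) (measure_ne_top _ _)
  have hmono : Monotone A := fun m n hmn x hx =>
    le_trans (ENNReal.inv_le_inv.2 (by exact_mod_cast hmn)) hx
  have hInter : ⋂ n, (A n)ᶜ ⊆ {x | μ {x} ≠ 0}ᶜ := by
    intro x hx hx0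
    obtain ⟨n, hn⟩ := ENNReal.exists_inv_nat_lt hx0
    exact Set.mem_iInter.1 hx n hn.le
  have hlim := tendsto_measure_iInter_atTop (μ := μ) (s := fun n => (A n)ᶜ)
    (fun n => (hfin n).measurableSet.compl.nullMeasurableSet)
    (fun m n hmn => Set.compl_subset_compl.2 (hmono hmn)) ⟨0, measure_ne_top _ _⟩
  rw [measure_mono_null hInter hμ] at hlim
  obtain ⟨n, hn⟩ := (hlim.eventually (ge_mem_nhds hε)).exists
  exact ⟨A n, hfin n, hn⟩

/-- Continuity of translation in `L¹`. -/
lemma tendsto_lintegral_enorm_translate_sub {d : ℕ} {g : (Fin d → ℝ) → ℝ}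
    (hg : MemLp g 1 volume) (v : ℝ → Fin d → ℝ) (hv : Continuous v) (hv0 : v 0 = 0) :
    Filter.Tendsto (fun t => ∫⁻ x, ‖g (x + v t) - g x‖ₑ) (nhds 0) (nhds 0) := by
  let τ : ℝ → C(Fin d → ℝ, Fin d → ℝ) := fun t => ⟨(· + v t), by fun_prop⟩
  have hτ : Continuous τ := by
    refine ContinuousMap.continuous_of_continuous_uncurry _ ?_
    change Continuous fun p : ℝ × (Fin d → ℝ) => p.2 + v p.1
    fun_prop
  have hmp : ∀ t, MeasurePreserving (τ t) volume volume := fun t =>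
    measurePreserving_add_right volume (v t)
  have hcont : Continuous fun t => Lp.compMeasurePreserving (τ t) (hmp t) (hg.toLp g) :=
    Continuous.compMeasurePreservingLp continuous_const hτ hmp one_ne_top
  have h0 : Lp.compMeasurePreserving (τ 0) (hmp 0) (hg.toLp g) = hg.toLp g := by
    rw [Lp.toLp_compMeasurePreserving]
    congr 1
    ext x
    simp [τ, hv0]
  have hlim := (hcont.edist (continuous_const (y := hg.toLp g))).tendsto 0
  rw [h0, edist_self] at hlim
  refine hlim.congr fun t => ?_
  rw [Lp.toLp_compMeasurePreserving, Lp.edist_toLp_toLp, eLpNorm_one_eq_lintegral_enorm]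
  rfl

lemma exists_le_shiftLaw {d : ℕ} {PC : Measure (Fin d → ℝ)} [IsProbabilityMeasure PC]
    (hC : PC ≪ (volume : Measure (Fin d → ℝ))) (i : Fin d) {ε : ℝ≥0∞} (hε : 0 < ε) :
    ∀ᶠ t in nhds (0 : ℝ), ∃ ν : Measure (Fin d → ℝ), ν ≤ shiftLaw PC 0 ∧
      ν ≤ shiftLaw PC (Pi.single i t) ∧ 1 ≤ ν Set.univ + ε := by
  let g : (Fin d → ℝ) → ℝ := fun x => (PC.rnDeriv volume x).toReal
  have hgm : Measurable g := (Measure.measurable_rnDeriv _ _).ennreal_toReal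
  have hPC : volume.withDensity (fun x => ‖g x‖ₑ) = PC := by
    rw [← Measure.withDensity_rnDeriv_eq _ _ hC]
    refine withDensity_congr_ae ?_
    filter_upwards [Measure.rnDeriv_lt_top PC volume] with x hx
    rw [Real.enorm_of_nonneg toReal_nonneg, ofReal_toReal hx.ne]
  have hone : ∫⁻ x, ‖g x‖ₑ = 1 := by
    rw [← setLIntegral_univ, ← withDensity_apply _ .univ, hPC, measure_univ]
  have hg : MemLp g 1 volume := ⟨hgm.aestronglyMeasurable, by
    rw [eLpNorm_one_eq_lintegral_enorm, hone]; exact one_lt_top⟩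
  have hshift : ∀ u : Fin d → ℝ,
      shiftLaw PC u = volume.withDensity (fun x => ‖g (x + u)‖ₑ) := by
    intro u
    ext s hs
    rw [shiftLaw_apply]
    nth_rewrite 1 [← hPC]
    rw [withDensity_apply _ hs, withDensity_apply _ (hs.preimage (by fun_prop)),
      ← (measurePreserving_sub_right volume u).setLIntegral_comp_preimage hs (by fun_prop)]
    simp
  have hlim := tendsto_lintegral_enorm_translate_sub hg (fun t => Pi.single i t)
    (continuous_single (A := fun _ => ℝ) i) (Pi.single_zero i)
  filter_upwards [hlim.eventually (ge_mem_nhds hε)] with t ht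
  refine ⟨volume.withDensity fun x => min ‖g x‖ₑ ‖g (x + Pi.single i t)‖ₑ, ?_, ?_, ?_⟩
  · rw [hshift]
    exact withDensity_mono (.of_forall fun x => by simp)
  · rw [hshift]
    exact withDensity_mono (.of_forall fun x => min_le_right _ _)
  · rw [withDensity_apply _ .univ, setLIntegral_univ, ← hone]
    refine le_trans ?_ (add_le_add le_rfl ht)
    rw [← lintegral_add_left (by fun_prop)]
    refine lintegral_mono fun x => ?_
    rcases le_total ‖g x‖ₑ ‖g (x + Pi.single i t)‖ₑ with h | h
    · rw [min_eq_left h]; exact le_self_add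
    · rw [min_eq_right h, enorm_sub_rev]
      calc ‖g x‖ₑ = ‖g (x + Pi.single i t) + (g x - g (x + Pi.single i t))‖ₑ := by
            congr 1; ring
        _ ≤ _ := enorm_add_le _ _

lemma ZZ_two {d : ℕ} (P : Measure (Fin d → ℝ)) (κ : Kernel (Fin d → ℝ) (Fin d → ℝ)) :
    ZZ P κ 2 = ∑ i : Fin d, ∫⁻ t in Set.Ioi (0 : ℝ), ENNReal.ofReal (t / 2) * hFun P κ 2 t i := by
  have : ((2 : ℕ) : ℝ≥0∞) - 1 = 1 := by
    rw [← Nat.cast_one, ← ENNReal.natCast_sub]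
  simp only [ZZ, this, div_one]

/-- **Low-noise asymptotics of the Ziv–Zakai bound (Theorem 3).**
For the additive Gaussian noise channel `Y = X + N`, `N ∼ N(0, ηI_d)`, and a mixed input
`P_X = α P_C + (1−α) P_D` with `P_C` absolutely continuous and `P_D` purely atomic,
`lim_{η→0} ZZ(P_X, P_{Y|X}^{(η)}, 2)/η = α d`. -/
theorem low_noise_asymptotics
    {d : ℕ} (hd : 1 ≤ d)
    (PC PD : Measure (Fin d → ℝ)) [IsProbabilityMeasure PC] [IsProbabilityMeasure PD]
    (hC : PC ≪ (volume : Measure (Fin d → ℝ)))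
    (hD : PD {x | PD {x} ≠ 0}ᶜ = 0)
    (α : NNReal) (hα : α ≤ 1)
    (P : Measure (Fin d → ℝ))
    (hP : P = (α : ℝ≥0∞) • PC + ((1 - α : NNReal) : ℝ≥0∞) • PD) :
    Filter.Tendsto (fun η : NNReal => ZZ P (gaussKernel d η) 2 / (η : ℝ≥0∞))
      (nhdsWithin 0 (Set.Ioi 0)) (nhds ((α : ℝ≥0∞) * d)) := by
  have hα1 : (α : ℝ≥0∞) ≤ 1 := by exact_mod_cast hα
  have hβ1 : ((1 - α : NNReal) : ℝ≥0∞) ≤ 1 := by exact_mod_cast tsub_le_self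
  have hprob : IsProbabilityMeasure P := by
    refine ⟨?_⟩
    simp only [hP, Measure.add_apply, Measure.smul_apply, measure_univ, smul_eq_mul, mul_one]
    exact_mod_cast add_tsub_cancel_of_le hα
  have hPle : ∀ s, P s ≤ α * PC s + PD s := fun s => by
    simp only [hP, Measure.add_apply, Measure.smul_apply, smul_eq_mul]
    gcongr
    exact mul_le_of_le_one_left' hβ1
  have hshift : ∀ u ν, ν ≤ shiftLaw PC u → (α : ℝ≥0∞) • ν ≤ shiftLaw P u := fun u ν hν => by
    refine Measure.le_iff'.2 fun s => ?_
    rw [shiftLaw_apply, hP, Measure.smul_apply, Measure.add_apply, Measure.smul_apply,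
      ← shiftLaw_apply]
    exact le_add_right (mul_le_mul_right (hν s) _)
  simp_rw [ZZ_two, ENNReal.div_eq_inv_mul, Finset.mul_sum, ← ENNReal.div_eq_inv_mul]
  have hsum : (α : ℝ≥0∞) * d = ∑ _i : Fin d, (α : ℝ≥0∞) := by simp [mul_comm]
  rw [hsum]
  refine tendsto_finsetSum _ fun i _ => tendsto_lintegral_div_of_near_twoTail hα1
    (H := fun η t => hFun P (gaussKernel d η) 2 t i)
    (fun η _ t ht => hFun_gaussKernel_le_twoTail ht i) fun ε hε => ?_
  have hε3 : 0 < ε / 3 := ENNReal.div_pos hε.ne' (by simp)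
  obtain ⟨F, hF, hPDF⟩ := exists_finite_measure_compl_le PD hD hε3
  have hsep : ∀ᶠ t in nhdsWithin (0 : ℝ) (Set.Ioi 0), ∀ x ∈ F, ∀ y ∈ F, x i - y i ≠ t := by
    refine (hF.eventually_all).2 fun x _ => (hF.eventually_all).2 fun y _ => ?_
    rcases eq_or_ne (x i - y i) 0 with h | h
    · filter_upwards [self_mem_nhdsWithin] with t (ht : 0 < t)
      rw [h]; exact ht.ne
    · exact ((eventually_ne_nhds h.symm).filter_mono nhdsWithin_le_nhds).mono fun t ht => ht.symm
  filter_upwards [hsep, nhdsWithin_le_nhds (exists_le_shiftLaw hC i hε), self_mem_nhdsWithin]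
    with t hsep ⟨ν, hν0, hν1, hν⟩ (ht : 0 < t) η hη
  constructor
  · have hcompl : P Fᶜ ≤ α + ε / 3 := (hPle _).trans <|
      add_le_add (mul_le_of_le_one_right' prob_le_one) hPDF
    have hG : ∀ G : Set (Fin d → ℝ), G.Finite → Disjoint G F → P G ≤ ε / 3 := by
      have : Nonempty (Fin d) := ⟨i⟩
      intro G hGfin hGF
      refine (hPle G).trans ?_
      rw [hC (hGfin.measure_zero volume), mul_zero, zero_add]
      exact (measure_mono hGF.subset_compl_right).trans hPDF
    refine (hFun_gaussKernel_le_add ht i hF hcompl hG hsep).trans ?_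
    calc (α + ε / 3) * twoTail η t + (ε / 3 + ε / 3)
        ≤ α * twoTail η t + ε / 3 + (ε / 3 + ε / 3) := by
          rw [add_mul]
          gcongr
          exact mul_le_of_le_one_right' (twoTail_le_one η t)
      _ = α * twoTail η t + ε := by
          rw [add_assoc, ← add_assoc (ε / 3), ENNReal.add_thirds]
  · have h := measure_univ_mul_twoTail_le_hFun hη ht i
      (hshift _ _ hν0) (hshift _ _ hν1)
    calc α * twoTail η t ≤ α * twoTail η t * (ν Set.univ + ε) := le_mul_of_one_le_right' hν
      _ = ((α : ℝ≥0∞) • ν) Set.univ * twoTail η t + α * twoTail η t * ε := by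
          rw [Measure.smul_apply, smul_eq_mul]; ring
      _ ≤ _ := by
          refine add_le_add h (mul_le_of_le_one_left' ?_)
          exact mul_le_one' hα1 (twoTail_le_one η t)
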